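/- Indistinguishability under an interior distribution (Theorem B.1). Suppose Assumption 1 holds, 𝓕 is convex, and r₁(·;θ) is F-integrable for every F ∈ 𝓕. Fix θ ∈ Θ. If there exists F* ∈ 𝓕 such that ∫ r₁(z;θ) dF* = 0 and inf_{λ ∈ 𝒮₂} ∫ γ₂(λ,z;θ) dF* > 0 (including the case where this infimum equals +∞), then the hypothesis θ ∈ Θ_I(F) is impossible to distinguish from the hypothesis θ ∈ Θ̄_I(F) in finite samples. -/

import Mathlib

open MeasureTheory Set
open scoped ENNReal RealInnerProductSpace

noncomputable section

/-- The positive part of an extended real, as an extended nonnegative real. -/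
def EReal.posPart (x : EReal) : ℝ≥0∞ := if x = ⊤ then ⊤ else ENNReal.ofReal x.toReal

/-- The integral of an `EReal`-valued function: the integral of its positive part
minus the integral of its negative part (an element of `EReal`). -/
def integralEReal {𝓩 : Type*} [MeasurableSpace 𝓩] (F : Measure 𝓩) (f : 𝓩 → EReal) : EReal :=
  ((∫⁻ z, (f z).posPart ∂F : ℝ≥0∞) : EReal) - ((∫⁻ z, (-(f z)).posPart ∂F : ℝ≥0∞) : EReal)

variable {𝓤 𝓩 : Type*}
  [MeasurableSpace 𝓤] [TopologicalSpace 𝓤] [PolishSpace 𝓤] [BorelSpace 𝓤]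
  [MeasurableSpace 𝓩] [TopologicalSpace 𝓩] [PolishSpace 𝓩] [BorelSpace 𝓩]
  {Θ : Type*}

/-- The section `Γ(z;θ) = {u : (u,z) ∈ Γ(θ)}`. -/
def sectionSet (Γθ : Set (𝓤 × 𝓩)) (z : 𝓩) : Set 𝓤 := {u | (u, z) ∈ Γθ}

/-- The set `𝓡(z;θ)` of moment values consistent with the support restriction at `z`. -/
def momentSet {d : ℕ} (Γθ : Set (𝓤 × 𝓩)) (rθ : 𝓤 → 𝓩 → EuclideanSpace ℝ (Fin d)) (z : 𝓩) :
    Set (EuclideanSpace ℝ (Fin d)) := (fun u => rθ u z) '' sectionSet Γθ z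

/-- The support function `γ(λ,z;θ) = sup {λᵀt : t ∈ 𝓡(z;θ)}`, with values in `EReal`. -/
def suppFun {d : ℕ} (Γθ : Set (𝓤 × 𝓩)) (rθ : 𝓤 → 𝓩 → EuclideanSpace ℝ (Fin d))
    (l : EuclideanSpace ℝ (Fin d)) (z : 𝓩) : EReal :=
  sSup ((fun t => ((⟪l, t⟫ : ℝ) : EReal)) '' momentSet Γθ rθ z)

/-- Assumption 1 at a single parameter value and a single distribution. -/
structure Assumption1At {d : ℕ} (F : Measure 𝓩) (Γθ : Set (𝓤 × 𝓩))
    (rθ : 𝓤 → 𝓩 → EuclideanSpace ℝ (Fin d)) : Prop where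
  borel_Gamma : MeasurableSet Γθ
  nonempty_section : ∀ z, (sectionSet Γθ z).Nonempty
  borel_section : ∀ z, MeasurableSet (sectionSet Γθ z)
  measurable_r : Measurable fun p : 𝓤 × 𝓩 => rθ p.1 p.2
  lower_envelope : ∃ g : 𝓩 → ℝ, Measurable g ∧ Integrable g F ∧
    ∀ᵐ z ∂F, sInf (norm '' momentSet Γθ rθ z) ≤ g z

/-- Assumption 1: measurability, nonempty sections, and an integrable lower envelope for
the infimum of the norm over the moment set. -/
def Assumption1 {d : ℕ} (𝓕 : Set (Measure 𝓩)) (Γ : Θ → Set (𝓤 × 𝓩))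
    (r : Θ → 𝓤 → 𝓩 → EuclideanSpace ℝ (Fin d)) : Prop :=
  ∀ θ : Θ, ∀ F ∈ 𝓕, Assumption1At F (Γ θ) (r θ)

/-- Assumption 2 at a single parameter value and distribution: closedness and
integrable boundedness of the moment sets. -/
structure Assumption2At {d : ℕ} (F : Measure 𝓩) (Γθ : Set (𝓤 × 𝓩))
    (rθ : 𝓤 → 𝓩 → EuclideanSpace ℝ (Fin d)) : Prop where
  closed_momentSet : ∀ᵐ z ∂F, IsClosed (momentSet Γθ rθ z)
  upper_envelope : ∃ g : 𝓩 → ℝ, Measurable g ∧ Integrable g F ∧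
    ∀ᵐ z ∂F, ∀ t ∈ momentSet Γθ rθ z, ‖t‖ ≤ g z

/-- Assumption 2 (closedness and integrable boundedness). -/
def Assumption2 {d : ℕ} (𝓕 : Set (Measure 𝓩)) (Γ : Θ → Set (𝓤 × 𝓩))
    (r : Θ → 𝓤 → 𝓩 → EuclideanSpace ℝ (Fin d)) : Prop :=
  ∀ θ : Θ, ∀ F ∈ 𝓕, Assumption2At F (Γ θ) (r θ)

/-- `θ` belongs to the identified set `Θ_I(F)`: there is a Borel probability measure `H`
on `𝓤 × 𝓩` giving probability one to the support restriction, with `𝓩`-marginal `F`,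
under which the moment function is integrable with mean zero. -/
def MemIdentified {d : ℕ} (Γθ : Set (𝓤 × 𝓩)) (rθ : 𝓤 → 𝓩 → EuclideanSpace ℝ (Fin d))
    (F : Measure 𝓩) : Prop :=
  ∃ H : Measure (𝓤 × 𝓩), IsProbabilityMeasure H ∧ H Γθ = 1 ∧ H.map Prod.snd = F ∧
    Integrable (fun p : 𝓤 × 𝓩 => rθ p.1 p.2) H ∧ (∫ p : 𝓤 × 𝓩, rθ p.1 p.2 ∂H) = 0

/-- `θ` belongs to the moment closure `Θ̄_I(F)` of the identified set. -/
def MemMomentClosure {d : ℕ} (Γθ : Set (𝓤 × 𝓩)) (rθ : 𝓤 → 𝓩 → EuclideanSpace ℝ (Fin d))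
    (F : Measure 𝓩) : Prop :=
  ∀ ε : ℝ, 0 < ε → ∃ H : Measure (𝓤 × 𝓩), IsProbabilityMeasure H ∧ H Γθ = 1 ∧
    H.map Prod.snd = F ∧ Integrable (fun p : 𝓤 × 𝓩 => rθ p.1 p.2) H ∧
    ‖∫ p : 𝓤 × 𝓩, rθ p.1 p.2 ∂H‖ ≤ ε

/-- `θ` belongs to the support-function set `Θ̃(F)`:
`∫ γ(λ,z;θ) dF ≥ 0` for every `λ` in the unit sphere. -/
def MemSFSet {d : ℕ} (Γθ : Set (𝓤 × 𝓩)) (rθ : 𝓤 → 𝓩 → EuclideanSpace ℝ (Fin d))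
    (F : Measure 𝓩) : Prop :=
  ∀ l : EuclideanSpace ℝ (Fin d), ‖l‖ = 1 → (0 : EReal) ≤ integralEReal F (suppFun Γθ rθ l)


/-- The combined moment function `r(u,z;θ) = (r₁(z;θ), r₂(u,z;θ))`, where `r₁` collects the
components that do not depend on the latent variable `u`. -/
def rComb {d1 d2 : ℕ} (r1θ : 𝓩 → EuclideanSpace ℝ (Fin d1))
    (r2θ : 𝓤 → 𝓩 → EuclideanSpace ℝ (Fin d2)) (u : 𝓤) (z : 𝓩) :
    EuclideanSpace ℝ (Fin (d1 + d2)) :=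
  (EuclideanSpace.equiv (Fin (d1 + d2)) ℝ).symm
    (Fin.append (EuclideanSpace.equiv (Fin d1) ℝ (r1θ z))
      (EuclideanSpace.equiv (Fin d2) ℝ (r2θ u z)))

/-- The partial support function `γ₂(λ,z;θ) = sup {λᵀ r₂(u,z;θ) : u ∈ Γ(z;θ)}`. -/
def suppFun2 {d2 : ℕ} (Γθ : Set (𝓤 × 𝓩)) (r2θ : 𝓤 → 𝓩 → EuclideanSpace ℝ (Fin d2))
    (l : EuclideanSpace ℝ (Fin d2)) (z : 𝓩) : EReal :=
  sSup ((fun u => ((⟪l, r2θ u z⟫ : ℝ) : EReal)) '' sectionSet Γθ z)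

/-- Convexity of a family of (probability) measures. -/
def ConvexFamily (𝓕 : Set (Measure 𝓩)) : Prop :=
  ∀ F₁ ∈ 𝓕, ∀ F₂ ∈ 𝓕, ∀ δ : ℝ, 0 ≤ δ → δ ≤ 1 →
    (ENNReal.ofReal δ • F₁ + ENNReal.ofReal (1 - δ) • F₂) ∈ 𝓕

/-- Finite-sample indistinguishability of the hypotheses `θ ∈ Θ_I(F)` and `θ ∈ Θ̄_I(F)`:
for every sample size `n` and every (measurable, `[0,1]`-valued) test `φ`, the supremum of the
rejection probability over `𝓕_θ` equals the supremum over `𝓕̄_θ`. -/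
def Indistinguishable {d : ℕ} (𝓕 : Set (Measure 𝓩)) (Γθ : Set (𝓤 × 𝓩))
    (rθ : 𝓤 → 𝓩 → EuclideanSpace ℝ (Fin d)) : Prop :=
  ∀ (n : ℕ) (φ : (Fin n → 𝓩) → ℝ), Measurable φ → (∀ x, φ x ∈ Set.Icc (0 : ℝ) 1) →
    sSup ((fun F : Measure 𝓩 => ∫ x, φ x ∂(Measure.pi fun _ : Fin n => F)) ''
        {F ∈ 𝓕 | MemIdentified Γθ rθ F}) =
      sSup ((fun F : Measure 𝓩 => ∫ x, φ x ∂(Measure.pi fun _ : Fin n => F)) ''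
        {F ∈ 𝓕 | MemMomentClosure Γθ rθ F})

/-! ### Measurable selection -/

/-- The points of `K` whose first coordinates are the entries of `w`, listed backwards. -/
def prefixSet (K : Set (ℕ → ℕ)) : List ℕ → Set (ℕ → ℕ)
  | [] => K
  | a :: w => prefixSet K w ∩ {x | x w.length = a}

lemma isCompact_prefixSet {K : Set (ℕ → ℕ)} (hK : IsCompact K) (w : List ℕ) :
    IsCompact (prefixSet K w) := by
  induction w with
  | nil => exact hK
  | cons a w ih =>
    exact ih.inter_right (isClosed_eq (continuous_apply w.length) continuous_const)

/-- A continuous map admits a measurable right inverse on the image of a compact subset of the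
Baire space. -/
lemma exists_measurable_rightInverse_of_isCompact {Z : Type*} [TopologicalSpace Z] [T2Space Z]
    [MeasurableSpace Z] [BorelSpace Z] {K : Set (ℕ → ℕ)} (hK : IsCompact K) {p : (ℕ → ℕ) → Z}
    (hp : Continuous p) :
    ∃ s : Z → ℕ → ℕ, Measurable s ∧ ∀ z ∈ p '' K, p (s z) = z := by
  classical
  let Q : List ℕ → Set Z := fun w => p '' prefixSet K w
  have hQ : ∀ w, MeasurableSet (Q w) := fun w =>
    ((isCompact_prefixSet hK w).image hp).isClosed.measurableSet
  have hex : ∀ (w : List ℕ) (z : Z), ∃ a, z ∈ Q (a :: w) ∨ z ∉ Q w := by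
    intro w z
    by_cases hz : z ∈ Q w
    · obtain ⟨x, hx, rfl⟩ := hz
      exact ⟨x w.length, Or.inl ⟨x, ⟨hx, rfl⟩, rfl⟩⟩
    · exact ⟨0, Or.inr hz⟩
  obtain ⟨N, hN, hNQ⟩ : ∃ N : List ℕ → Z → ℕ, (∀ w, Measurable (N w)) ∧
      ∀ w z, z ∈ Q w → z ∈ Q (N w z :: w) :=
    ⟨fun w z => Nat.find (hex w z),
      fun w => measurable_find (hex w) fun a => (hQ (a :: w)).union (hQ w).compl,
      fun w z hz => (Nat.find_spec (hex w z)).resolve_right (not_not_intro hz)⟩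
  obtain ⟨P, hP0, hP⟩ : ∃ P : ℕ → Z → List ℕ,
      P 0 = (fun _ => []) ∧ ∀ k, P (k + 1) = fun z => N (P k z) z :: P k z :=
    ⟨fun k z => Nat.rec [] (fun _ w => N w z :: w) k, rfl, fun _ => rfl⟩
  have hPlen : ∀ k z, (P k z).length = k := by
    intro k z
    induction k with
    | zero => simp [hP0]
    | succ k ih => simp [hP, ih]
  let _ : MeasurableSpace (List ℕ) := ⊤
  have hPmeas : ∀ k, Measurable (P k) := by
    intro k
    induction k with
    | zero => rw [hP0]; exact measurable_const
    | succ k ih =>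
      rw [hP]
      have h : Measurable fun q : List ℕ × Z => N q.1 q.2 :: q.1 := by
        refine measurable_from_prod_countable_right fun w => ?_
        exact (measurable_from_top (f := fun a : ℕ => a :: w)).comp (hN w)
      exact h.comp (ih.prodMk measurable_id)
  refine ⟨fun z k => N (P k z) z, measurable_pi_lambda _ fun k => ?_, fun z hz => ?_⟩
  · have h : Measurable fun q : List ℕ × Z => N q.1 q.2 :=
      measurable_from_prod_countable_right fun w => hN w
    exact h.comp ((hPmeas k).prodMk measurable_id)
  · have hmem : ∀ k, z ∈ Q (P k z) := by
      intro k
      induction k with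
      | zero => rw [hP0]; exact hz
      | succ k ih => rw [hP]; exact hNQ _ z ih
    choose y hyK hyz using hmem
    have hagree : ∀ k (x : ℕ → ℕ), x ∈ prefixSet K (P k z) → ∀ i < k, x i = N (P i z) z := by
      intro k
      induction k with
      | zero => intro x _ i hi; omega
      | succ k ih =>
        rw [hP]
        rintro x ⟨hx, hxk⟩ i hi
        rcases Nat.lt_succ_iff_lt_or_eq.mp hi with h | rfl
        · exact ih x hx i h
        · have h2 : x (P i z).length = N (P i z) z := hxk
          rwa [hPlen] at h2
    have hlim : Filter.Tendsto y Filter.atTop (nhds fun k => N (P k z) z) := by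
      refine tendsto_pi_nhds.mpr fun i => tendsto_const_nhds.congr' ?_
      filter_upwards [Filter.eventually_gt_atTop i] with k hk
      exact (hagree k (y k) (hyK k) i hk).symm
    refine tendsto_nhds_unique ((hp.tendsto _).comp hlim) ?_
    simp [Function.comp_def, hyz]

/-- The image of the Baire space under a continuous map is approximated in measure from inside by
images of compact sets. -/
lemma exists_isCompact_measure_range_le {Z : Type*} [TopologicalSpace Z] [T2Space Z]
    [MeasurableSpace Z] (F : Measure Z) [IsFiniteMeasure F] [F.OuterRegular] {p : (ℕ → ℕ) → Z}
    (hp : Continuous p) {ε : ℝ≥0∞} (hε : ε ≠ 0) :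
    ∃ K : Set (ℕ → ℕ), IsCompact K ∧ F (range p) ≤ F (p '' K) + ε := by
  have hε2 : ε / 2 ≠ 0 := (ENNReal.half_pos hε).ne'
  obtain ⟨e, he, hesum⟩ := ENNReal.exists_pos_sum_of_countable' hε2 ℕ
  have hstep : ∀ (k : ℕ) (S : Set (ℕ → ℕ)), ∃ m : ℕ,
      F (p '' S) ≤ F (p '' (S ∩ {x | x k ≤ m})) + e k := by
    intro k S
    have hmono : Monotone fun m : ℕ => p '' (S ∩ {x | x k ≤ m}) := fun a b hab =>
      image_mono (inter_subset_inter_right _ fun x (hx : x k ≤ a) => hx.trans hab)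
    have hU : p '' S = ⋃ m : ℕ, p '' (S ∩ {x | x k ≤ m}) := by
      rw [← image_iUnion, ← inter_iUnion]
      congr 1
      refine (inter_eq_left.mpr fun x _ => mem_iUnion.mpr ⟨x k, le_refl (x k)⟩).symm
    have hF : F (p '' S) = ⨆ m : ℕ, F (p '' (S ∩ {x | x k ≤ m})) := by
      rw [hU]; exact hmono.measure_iUnion
    by_cases h0 : F (p '' S) = 0
    · exact ⟨0, by simp [h0]⟩
    · have hlt : F (p '' S) - e k < ⨆ m : ℕ, F (p '' (S ∩ {x | x k ≤ m})) := by
        rw [← hF]; exact ENNReal.sub_lt_self (measure_ne_top F _) h0 (he k).ne'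
      obtain ⟨m, hm⟩ := lt_iSup_iff.mp hlt
      exact ⟨m, tsub_le_iff_right.mp hm.le⟩
  choose m hm using hstep
  let S : ℕ → Set (ℕ → ℕ) := fun k => Nat.rec univ (fun k S => S ∩ {x | x k ≤ m k S}) k
  let n : ℕ → ℕ := fun k => m k (S k)
  have hS : ∀ k x, x ∈ S k ↔ ∀ i < k, x i ≤ n i := by
    intro k x
    induction k with
    | zero => simp [S]
    | succ k ih =>
      have : x ∈ S (k + 1) ↔ x ∈ S k ∧ x k ≤ n k := Iff.rfl
      rw [this, ih, Nat.forall_lt_succ_right]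
  have hsum : ∀ k, F (range p) ≤ F (p '' S k) + ∑ i ∈ Finset.range k, e i := by
    intro k
    induction k with
    | zero => simp [S]
    | succ k ih =>
      refine ih.trans ?_
      rw [Finset.sum_range_succ, add_comm _ (e k), ← add_assoc]
      gcongr
      exact hm k (S k)
  let K : Set (ℕ → ℕ) := Set.pi univ fun i => Iic (n i)
  have hK : IsCompact K := isCompact_univ_pi fun i => (finite_Iic (n i)).isCompact
  refine ⟨K, hK, ?_⟩
  obtain ⟨U, hKU, hUo, hU⟩ := (p '' K).exists_isOpen_le_add F hε2
  let _ : MetricSpace (ℕ → ℕ) := PiNat.metricSpaceNatNat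
  obtain ⟨δ, hδ, hthick⟩ := hK.exists_thickening_subset_open (hUo.preimage hp)
    (image_subset_iff.mp hKU)
  obtain ⟨k, hk⟩ := exists_pow_lt_of_lt_one hδ (by norm_num : (1 / 2 : ℝ) < 1)
  have hSU : p '' S k ⊆ U := by
    rintro _ ⟨x, hx, rfl⟩
    refine hthick (Metric.mem_thickening_iff.mpr ⟨fun i => if i < k then x i else 0, ?_, ?_⟩)
    · intro i _
      by_cases hi : i < k
      · simpa [hi] using (hS k x).mp hx i hi
      · simp [hi]
    · refine lt_of_le_of_lt (PiNat.mem_cylinder_iff_dist_le.mp fun i hi => ?_) hk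
      simp [hi]
  calc F (range p) ≤ F (p '' S k) + ∑ i ∈ Finset.range k, e i := hsum k
    _ ≤ F U + ε / 2 := by
      gcongr
      exact (ENNReal.sum_le_tsum _).trans hesum.le
    _ ≤ F (p '' K) + ε / 2 + ε / 2 := by gcongr
    _ = F (p '' K) + ε := by rw [add_assoc, ENNReal.add_halves]

/-- A continuous map on the Baire space has a measurable right inverse on a measurable subset of
full measure in its range. -/
lemma exists_measurable_rightInverse_of_continuous {Z : Type*} [TopologicalSpace Z] [T2Space Z]
    [MeasurableSpace Z] [BorelSpace Z] (F : Measure Z) [IsFiniteMeasure F] [F.OuterRegular]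
    {p : (ℕ → ℕ) → Z} (hp : Continuous p) :
    ∃ S : Set Z, MeasurableSet S ∧ S ⊆ range p ∧ F (range p \ S) = 0 ∧
      ∃ s : Z → ℕ → ℕ, Measurable s ∧ ∀ z ∈ S, p (s z) = z := by
  classical
  choose K hK hFK using fun n : ℕ => exists_isCompact_measure_range_le F hp
    (ε := ((n : ℝ≥0∞) + 1)⁻¹) (by simp)
  choose s hs hsK using fun n => exists_measurable_rightInverse_of_isCompact (hK n) hp
  have hKm : ∀ n, MeasurableSet (p '' K n) := fun n => ((hK n).image hp).isClosed.measurableSet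
  let S : Set Z := ⋃ n, p '' K n
  have hSm : MeasurableSet S := MeasurableSet.iUnion hKm
  have hSr : S ⊆ range p := iUnion_subset fun n => image_subset_range _ _
  refine ⟨S, hSm, hSr, ?_, ?_⟩
  · rw [measure_sdiff hSr hSm.nullMeasurableSet (measure_ne_top F S), tsub_eq_zero_iff_le]
    refine ENNReal.le_of_forall_pos_le_add fun ε hε _ => ?_
    obtain ⟨n, hn⟩ := ENNReal.exists_inv_nat_lt (ENNReal.coe_pos.mpr hε).ne'
    refine (hFK n).trans (add_le_add (measure_mono
      (subset_iUnion (fun n => p '' K n) n)) (le_trans ?_ hn.le))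
    exact ENNReal.inv_le_inv.mpr le_self_add
  · have hex : ∀ z, ∃ n, z ∈ p '' K n ∪ Sᶜ := by
      intro z
      by_cases hz : z ∈ S
      · obtain ⟨n, hn⟩ := mem_iUnion.mp hz
        exact ⟨n, Or.inl hn⟩
      · exact ⟨0, Or.inr hz⟩
    refine ⟨fun z => s (Nat.find (hex z)) z,
      Measurable.find (p := fun n z => z ∈ p '' K n ∪ Sᶜ) hs
        (fun n => (hKm n).union hSm.compl) hex, fun z hz => ?_⟩
    exact hsK _ z ((Nat.find_spec (hex z)).resolve_right (not_not_intro hz))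

/-- Measurable selection: a Borel set in a product of Polish spaces has a measurable section
over a measurable subset of full measure in its projection. -/
lemma exists_measurable_section {U Z : Type*} [Nonempty U]
    [MeasurableSpace U] [TopologicalSpace U] [PolishSpace U] [BorelSpace U]
    [MeasurableSpace Z] [TopologicalSpace Z] [PolishSpace Z] [BorelSpace Z]
    (F : Measure Z) [IsFiniteMeasure F] {B : Set (U × Z)} (hB : MeasurableSet B) :
    ∃ S : Set Z, MeasurableSet S ∧ S ⊆ Prod.snd '' B ∧ F (Prod.snd '' B \ S) = 0 ∧
      ∃ u : Z → U, Measurable u ∧ ∀ z ∈ S, (u z, z) ∈ B := by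
  have hA := hB.analyticSet
  rw [AnalyticSet] at hA
  rcases hA with rfl | ⟨f, hf, rfl⟩
  · exact ⟨∅, by simp, by simp, by simp, fun _ => Classical.arbitrary U, measurable_const, by simp⟩
  · obtain ⟨S, hSm, hSr, hS0, s, hs, hsS⟩ :=
      exists_measurable_rightInverse_of_continuous F (continuous_snd.comp hf)
    rw [range_comp] at hSr hS0
    refine ⟨S, hSm, hSr, hS0, fun z => (f (s z)).1, (hf.fst.measurable).comp hs, fun z hz => ?_⟩
    exact ⟨s z, Prod.ext rfl (hsS z hz)⟩

lemma nullMeasurableSet_snd_image {U Z : Type*}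
    [MeasurableSpace U] [TopologicalSpace U] [PolishSpace U] [BorelSpace U]
    [MeasurableSpace Z] [TopologicalSpace Z] [PolishSpace Z] [BorelSpace Z]
    (F : Measure Z) [IsFiniteMeasure F] {B : Set (U × Z)} (hB : MeasurableSet B) :
    NullMeasurableSet (Prod.snd '' B) F := by
  rcases isEmpty_or_nonempty U with h | h
  · rw [B.eq_empty_of_isEmpty, image_empty]
    exact MeasurableSet.empty.nullMeasurableSet
  · obtain ⟨S, hSm, hSr, hS0, -⟩ := exists_measurable_section F hB
    exact hSm.nullMeasurableSet.congr
      (hSr.eventuallyLE.antisymm (ae_le_set.mpr hS0))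

lemma exists_measurable_selection {U Z : Type*} [Nonempty U]
    [MeasurableSpace U] [TopologicalSpace U] [PolishSpace U] [BorelSpace U]
    [MeasurableSpace Z] [TopologicalSpace Z] [PolishSpace Z] [BorelSpace Z]
    (F : Measure Z) [IsFiniteMeasure F] {B : Set (U × Z)} (hB : MeasurableSet B)
    (hne : ∀ᵐ z ∂F, ∃ u, (u, z) ∈ B) :
    ∃ u : Z → U, Measurable u ∧ ∀ᵐ z ∂F, (u z, z) ∈ B := by
  obtain ⟨S, -, -, hS0, u, hu, huS⟩ := exists_measurable_section F hB
  refine ⟨u, hu, ?_⟩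
  filter_upwards [hne, measure_eq_zero_iff_ae_notMem.mp hS0] with z ⟨v, hv⟩ hz
  exact huS z (by_contra fun h => hz ⟨⟨(v, z), hv, rfl⟩, h⟩)

/-! ### Supporting hyperplanes at the origin -/

/-- A nonempty convex set in a finite-dimensional space that meets every open half-space whose
boundary passes through the origin has the origin in its interior. -/
lemma Convex.zero_mem_interior_of_forall_exists_inner_pos {E : Type*} [NormedAddCommGroup E]
    [InnerProductSpace ℝ E] [FiniteDimensional ℝ E] {M : Set E} (hM : Convex ℝ M)
    (hne : M.Nonempty) (h : ∀ l : E, ‖l‖ = 1 → ∃ m ∈ M, 0 < ⟪l, m⟫) :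
    (0 : E) ∈ interior M := by
  have h' : ∀ l : E, l ≠ 0 → ∃ m ∈ M, 0 < ⟪l, m⟫ := by
    intro l hl
    obtain ⟨m, hm, hpos⟩ := h (‖l‖⁻¹ • l) (norm_smul_inv_norm hl)
    rw [real_inner_smul_left] at hpos
    exact ⟨m, hm, pos_of_mul_pos_right hpos (by positivity)⟩
  have hint : (interior M).Nonempty := by
    rw [hM.interior_nonempty_iff_affineSpan_eq_top]
    by_contra hspan
    rw [← AffineSubspace.direction_eq_top_iff_of_nonempty ((affineSpan_nonempty ℝ).mpr hne),
      ← Submodule.orthogonal_eq_bot_iff, Submodule.eq_bot_iff] at hspan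
    push Not at hspan
    obtain ⟨l, hl, hl0⟩ := hspan
    obtain ⟨m₁, hm₁, h₁⟩ := h' l hl0
    obtain ⟨m₂, hm₂, h₂⟩ := h' (-l) (neg_ne_zero.mpr hl0)
    have h₀ := (Submodule.mem_orthogonal' _ l).mp hl (m₁ - m₂)
      (AffineSubspace.vsub_mem_direction (subset_affineSpan ℝ M hm₁) (subset_affineSpan ℝ M hm₂))
    rw [inner_sub_right] at h₀
    rw [inner_neg_left] at h₂
    linarith
  by_contra h0
  obtain ⟨f, hf⟩ := geometric_hahn_banach_open_point hM.interior isOpen_interior h0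
  rw [map_zero] at hf
  have hle : ∀ m ∈ M, f m ≤ 0 := by
    intro m hm
    have hcl : m ∈ closure (interior M) := by
      rw [hM.closure_interior_eq_closure_of_nonempty_interior hint]
      exact subset_closure hm
    exact closure_minimal (fun x hx => (hf x hx).le) (isClosed_le f.continuous continuous_const) hcl
  obtain ⟨x, hx⟩ := hint
  have hf0 : (InnerProductSpace.toDual ℝ E).symm f ≠ 0 := by
    intro hz
    rw [map_eq_zero_iff _ (InnerProductSpace.toDual ℝ E).symm.injective] at hz
    simpa [hz] using hf x hx
  obtain ⟨m, hm, hpos⟩ := h' _ hf0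
  rw [InnerProductSpace.toDual_symm_apply] at hpos
  exact absurd (hle m hm) hpos.not_ge

/-! ### Attainable moments -/

section AttainableMoments

variable {U Z E : Type*} [MeasurableSpace U] [MeasurableSpace Z] [NormedAddCommGroup E]
  [NormedSpace ℝ E]

/-- The values of the integrals of `ρ` under the joint probability laws that are supported on `G`
and have second marginal `F`. -/
def attainableMoments (G : Set (U × Z)) (ρ : U × Z → E) (F : Measure Z) : Set E :=
  {m | ∃ H : Measure (U × Z), IsProbabilityMeasure H ∧ H G = 1 ∧ H.map Prod.snd = F ∧
    Integrable ρ H ∧ ∫ p, ρ p ∂H = m}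

lemma add_mem_attainableMoments {G : Set (U × Z)} {ρ : U × Z → E} {F₁ F₂ : Measure Z} {m₁ m₂ : E}
    (h₁ : m₁ ∈ attainableMoments G ρ F₁) (h₂ : m₂ ∈ attainableMoments G ρ F₂) {δ : ℝ}
    (hδ0 : 0 ≤ δ) (hδ1 : δ ≤ 1) :
    δ • m₁ + (1 - δ) • m₂ ∈
      attainableMoments G ρ (ENNReal.ofReal δ • F₁ + ENNReal.ofReal (1 - δ) • F₂) := by
  obtain ⟨H₁, hp₁, hG₁, rfl, hi₁, rfl⟩ := h₁
  obtain ⟨H₂, hp₂, hG₂, rfl, hi₂, rfl⟩ := h₂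
  have hsum : ENNReal.ofReal δ + ENNReal.ofReal (1 - δ) = 1 := by
    rw [← ENNReal.ofReal_add hδ0 (sub_nonneg.mpr hδ1)]; simp
  have hj₁ : Integrable ρ (ENNReal.ofReal δ • H₁) := hi₁.smul_measure ENNReal.ofReal_ne_top
  have hj₂ : Integrable ρ (ENNReal.ofReal (1 - δ) • H₂) :=
    hi₂.smul_measure ENNReal.ofReal_ne_top
  refine ⟨ENNReal.ofReal δ • H₁ + ENNReal.ofReal (1 - δ) • H₂, ⟨by simp [hsum]⟩,
    by simp [hG₁, hG₂, hsum], ?_, hj₁.add_measure hj₂, ?_⟩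
  · rw [Measure.map_add _ _ measurable_snd, Measure.map_smul, Measure.map_smul]
  · rw [integral_add_measure hj₁ hj₂, integral_smul_measure, integral_smul_measure,
      ENNReal.toReal_ofReal hδ0, ENNReal.toReal_ofReal (sub_nonneg.mpr hδ1)]

lemma convex_attainableMoments (G : Set (U × Z)) (ρ : U × Z → E) (F : Measure Z) :
    Convex ℝ (attainableMoments G ρ F) := by
  intro m₁ h₁ m₂ h₂ a b ha hb hab
  obtain rfl : b = 1 - a := by linarith
  have h := add_mem_attainableMoments h₁ h₂ ha (by linarith)
  rwa [← add_smul, ← ENNReal.ofReal_add ha hb, hab, ENNReal.ofReal_one, one_smul] at h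

lemma integral_mem_attainableMoments {G : Set (U × Z)} (hG : MeasurableSet G) {ρ : U × Z → E}
    (hρ : StronglyMeasurable ρ) {F : Measure Z} [IsProbabilityMeasure F] {u : Z → U}
    (hu : Measurable u) (huG : ∀ᵐ z ∂F, (u z, z) ∈ G) (hint : Integrable (fun z => ρ (u z, z)) F) :
    ∫ z, ρ (u z, z) ∂F ∈ attainableMoments G ρ F := by
  have hm : Measurable fun z => (u z, z) := hu.prodMk measurable_id
  have hH : IsProbabilityMeasure (F.map fun z => (u z, z)) :=
    Measure.isProbabilityMeasure_map hm.aemeasurable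
  refine ⟨F.map fun z => (u z, z), hH, ?_, ?_, ?_, ?_⟩
  · rw [prob_compl_eq_zero_iff hG |>.symm]
    exact (ae_map_iff hm.aemeasurable hG).mpr huG
  · rw [Measure.map_map measurable_snd hm]
    exact Measure.map_id
  · exact (integrable_map_measure hρ.aestronglyMeasurable hm.aemeasurable).mpr hint
  · exact integral_map hm.aemeasurable hρ.aestronglyMeasurable

end AttainableMoments

/-! ### Product measures -/

lemma pow_smul_pi_le_pi {n : ℕ} {Z : Type*} [MeasurableSpace Z] {F G : Measure Z}
    [IsFiniteMeasure F] [IsFiniteMeasure G] {c : ℝ≥0∞} (h : c • F ≤ G) :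
    c ^ n • Measure.pi (fun _ : Fin n => F) ≤ Measure.pi (fun _ : Fin n => G) := by
  have hle : (c ^ n • Measure.pi (fun _ : Fin n => F)).toOuterMeasure ≤
      OuterMeasure.pi fun _ : Fin n => G.toOuterMeasure := by
    refine OuterMeasure.le_pi.mpr fun s _ => ?_
    change c ^ n * Measure.pi (fun _ : Fin n => F) (Set.pi univ s) ≤ ∏ i, G (s i)
    calc c ^ n * Measure.pi (fun _ : Fin n => F) (Set.pi univ s) = ∏ i, c * F (s i) := by
          rw [Measure.pi_pi, Finset.prod_mul_distrib]; simp
      _ ≤ ∏ i, G (s i) := Finset.prod_le_prod' fun i _ => h (s i)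
  refine Measure.le_iff.mpr fun s hs => ?_
  rw [Measure.pi_def fun _ : Fin n => G, toMeasure_apply _ _ hs]
  exact hle s

/-! ### The support function of the moments -/

lemma EReal.measurable_posPart : Measurable EReal.posPart :=
  Measurable.ite (measurableSet_singleton ⊤) measurable_const
    (ENNReal.measurable_ofReal.comp measurable_ereal_toReal)

lemma EReal.posPart_neg_le_ofReal_abs {a : ℝ} {y : EReal} (h : (a : EReal) ≤ y) :
    (-y).posPart ≤ ENNReal.ofReal |a| := by
  induction y with
  | bot => simp at h
  | top => simp [EReal.posPart]
  | coe x =>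
    rw [← EReal.coe_neg, EReal.posPart, if_neg (EReal.coe_ne_top _), EReal.toReal_coe]
    exact ENNReal.ofReal_le_ofReal
      ((neg_le_neg (EReal.coe_le_coe_iff.mp h)).trans (neg_le_abs _))

lemma EReal.coe_sub_posPart_neg_sub_lt {y : EReal} (hy : y ≠ ⊥) {t : NNReal}
    (ht : (t : ℝ≥0∞) ≤ y.posPart) {ε : ℝ} (hε : 0 < ε) :
    (((t : ℝ) - (-y).posPart.toReal - ε : ℝ) : EReal) < y := by
  induction y with
  | bot => exact absurd rfl hy
  | top => exact EReal.coe_lt_top _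
  | coe x =>
    rw [EReal.posPart, if_neg (EReal.coe_ne_top _), EReal.toReal_coe,
      ← ENNReal.ofReal_coe_nnreal, ENNReal.ofReal_le_ofReal_iff'] at ht
    rw [← EReal.coe_neg, EReal.posPart, if_neg (EReal.coe_ne_top _), EReal.toReal_coe,
      EReal.coe_lt_coe_iff, ENNReal.toReal_ofReal']
    rcases le_total 0 x with hx | hx
    · rw [max_eq_right (by linarith)]
      rcases ht with h | h <;> linarith
    · rw [max_eq_left (by linarith)]
      rcases ht with h | h <;> linarith

lemma aemeasurable_suppFun2 {d2 : ℕ} (F : Measure 𝓩) [IsFiniteMeasure F] {G : Set (𝓤 × 𝓩)}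
    (hG : MeasurableSet G) {ρ : 𝓤 → 𝓩 → EuclideanSpace ℝ (Fin d2)}
    (hρ : Measurable fun p : 𝓤 × 𝓩 => ρ p.1 p.2) (l : EuclideanSpace ℝ (Fin d2)) :
    AEMeasurable (suppFun2 G ρ l) F := by
  refine NullMeasurable.aemeasurable (β := EReal) ?_
  refine measurable_of_Ioi (α := EReal) (δ := NullMeasurableSpace 𝓩 F) fun c => ?_
  change NullMeasurableSet (suppFun2 G ρ l ⁻¹' Ioi c) F
  have hset : suppFun2 G ρ l ⁻¹' Ioi c =
      Prod.snd '' (G ∩ {p | c < ((⟪l, ρ p.1 p.2⟫ : ℝ) : EReal)}) := by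
    ext z
    simp [suppFun2, lt_sSup_iff, sectionSet]
  have hB : MeasurableSet (G ∩ {p : 𝓤 × 𝓩 | c < ((⟪l, ρ p.1 p.2⟫ : ℝ) : EReal)}) :=
    hG.inter (measurableSet_lt measurable_const (measurable_const.inner hρ).coe_real_ereal)
  rw [hset]
  exact nullMeasurableSet_snd_image F hB

/-- If the support function in the direction `l` has positive integral, then some attainable moment
lies in the corresponding open half-space. -/
lemma exists_mem_attainableMoments_inner_pos {d2 : ℕ} (F : Measure 𝓩) [IsProbabilityMeasure F]
    {G : Set (𝓤 × 𝓩)} (hG : MeasurableSet G) {ρ : 𝓤 → 𝓩 → EuclideanSpace ℝ (Fin d2)}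
    (hρ : Measurable fun p : 𝓤 × 𝓩 => ρ p.1 p.2) {u₀ : 𝓩 → 𝓤} (hu₀ : Measurable u₀)
    (hu₀G : ∀ᵐ z ∂F, (u₀ z, z) ∈ G) (hint₀ : Integrable (fun z => ρ (u₀ z) z) F)
    (l : EuclideanSpace ℝ (Fin d2)) (hl : 0 < integralEReal F (suppFun2 G ρ l)) :
    ∃ m ∈ attainableMoments G (fun p => ρ p.1 p.2) F, 0 < ⟪l, m⟫ := by
  have hne : Nonempty 𝓤 := ⟨u₀ (Classical.choice (nonempty_of_isProbabilityMeasure F))⟩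
  set γ := suppFun2 G ρ l
  let a : 𝓩 → ℝ := fun z => ⟪l, ρ (u₀ z) z⟫
  have ha : Integrable a F := hint₀.const_inner l
  have haγ : ∀ᵐ z ∂F, (a z : EReal) ≤ γ z := by
    filter_upwards [hu₀G] with z hz
    exact le_sSup ⟨u₀ z, hz, rfl⟩
  let k : 𝓩 → ℝ≥0∞ := fun z => (-(γ z)).posPart
  have hk : AEMeasurable k F :=
    EReal.measurable_posPart.comp_aemeasurable
      (measurable_neg.comp_aemeasurable (aemeasurable_suppFun2 F hG hρ l))
  have hka : ∀ᵐ z ∂F, k z ≤ ENNReal.ofReal |a z| := by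
    filter_upwards [haγ] with z hz
    exact EReal.posPart_neg_le_ofReal_abs hz
  have hk_fin : ∫⁻ z, k z ∂F ≠ ⊤ :=
    ((lintegral_mono_ae hka).trans_lt ((hasFiniteIntegral_iff_norm a).mp ha.2)).ne
  have hlt : ∫⁻ z, k z ∂F < ∫⁻ z, (γ z).posPart ∂F := by
    by_contra! hle
    refine absurd hl (not_lt.mpr ?_)
    exact EReal.sub_nonpos.mpr (EReal.coe_ennreal_le_coe_ennreal_iff.mpr hle)
  rw [lintegral_eq_nnreal (fun z => (γ z).posPart)] at hlt
  simp only [lt_iSup_iff] at hlt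
  obtain ⟨φ, hφ, hlt⟩ := hlt
  have hφ_int : Integrable (fun z => (φ z : ℝ)) F := by
    obtain ⟨C, hC⟩ := (φ.map ((↑) : NNReal → ℝ)).exists_forall_norm_le
    exact Integrable.of_bound φ.measurable.coe_nnreal_real.aestronglyMeasurable C
      (Filter.Eventually.of_forall hC)
  have hφ_eq : (φ.map ((↑) : NNReal → ℝ≥0∞)).lintegral F =
      ENNReal.ofReal (∫ z, (φ z : ℝ) ∂F) := by
    rw [← SimpleFunc.lintegral_eq_lintegral, ← lintegral_coe_eq_integral _ hφ_int]
    rfl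
  let k' : 𝓩 → ℝ := fun z => (hk.mk k z).toReal
  have hk'k : ∀ᵐ z ∂F, k' z = (k z).toReal := by
    filter_upwards [hk.ae_eq_mk] with z hz
    rw [hz]
  have hk'_meas : Measurable k' := hk.measurable_mk.ennreal_toReal
  have hk'_int : Integrable k' F :=
    (integrable_toReal_of_lintegral_ne_top hk hk_fin).congr (hk'k.mono fun _ h => h.symm)
  have hk'_eq : ∫⁻ z, k z ∂F = ENNReal.ofReal (∫ z, k' z ∂F) := by
    rw [integral_congr_ae hk'k, integral_toReal hk (ae_lt_top' hk hk_fin),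
      ENNReal.ofReal_toReal hk_fin]
  rw [hφ_eq, hk'_eq] at hlt
  have hlt' : ∫ z, k' z ∂F < ∫ z, (φ z : ℝ) ∂F := ENNReal.ofReal_lt_ofReal_iff'.mp hlt |>.1
  set ε : ℝ := (∫ z, (φ z : ℝ) ∂F - ∫ z, k' z ∂F) / 2 with hε
  have hε0 : 0 < ε := by rw [hε]; linarith
  let b : 𝓩 → ℝ := fun z => φ z - k' z - ε
  have hb_meas : Measurable b :=
    (φ.measurable.coe_nnreal_real.sub hk'_meas).sub measurable_const
  have hb_int : Integrable b F := (hφ_int.sub hk'_int).sub (integrable_const ε)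
  have hb_pos : 0 < ∫ z, b z ∂F := by
    have : ∫ z, b z ∂F = ε := by
      have h := integral_sub (hφ_int.sub hk'_int) (integrable_const ε)
      have h' := integral_sub hφ_int hk'_int
      simp only [Pi.sub_apply, integral_const, probReal_univ, one_smul] at h h'
      rw [h, h', hε]; ring
    rwa [this]
  have hbγ : ∀ᵐ z ∂F, (b z : EReal) < γ z := by
    filter_upwards [haγ, hk'k] with z hz hz'
    simp only [b, hz']
    refine EReal.coe_sub_posPart_neg_sub_lt ?_ (hφ z) hε0
    exact ne_bot_of_le_ne_bot (EReal.coe_ne_bot _) hz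
  have hlρ : Measurable fun p : 𝓤 × 𝓩 => (⟪l, ρ p.1 p.2⟫ : ℝ) := measurable_const.inner hρ
  obtain ⟨u, hu, huB⟩ := exists_measurable_selection F
    (B := G ∩ {p | b p.2 < ⟪l, ρ p.1 p.2⟫})
    (hG.inter (measurableSet_lt (hb_meas.comp measurable_snd) hlρ)) (by
      filter_upwards [hbγ] with z hz
      obtain ⟨_, ⟨v, hv, rfl⟩, hlt⟩ := lt_sSup_iff.mp hz
      exact ⟨v, hv, EReal.coe_lt_coe_iff.mp hlt⟩)
  have hρu : Measurable fun z => ρ (u z) z := hρ.comp (hu.prodMk measurable_id)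
  let T : ℕ → Set 𝓩 := fun n => {z | ‖ρ (u z) z‖ ≤ n}
  have hT : ∀ n, MeasurableSet (T n) := fun n => measurableSet_le hρu.norm measurable_const
  classical
  let v : ℕ → 𝓩 → 𝓤 := fun n => (T n).piecewise u u₀
  let c : ℕ → 𝓩 → ℝ := fun n => (T n).piecewise b a
  have hv : ∀ n, Measurable (v n) := fun n => hu.piecewise (hT n) hu₀
  have hvG : ∀ n, ∀ᵐ z ∂F, (v n z, z) ∈ G := by
    intro n
    filter_upwards [hu₀G, huB] with z h₀ h
    by_cases hz : z ∈ T n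
    · simpa [v, hz] using h.1
    · simpa [v, hz] using h₀
  have hv_int : ∀ n, Integrable (fun z => ρ (v n z) z) F := by
    intro n
    refine ((integrable_const (n : ℝ)).add hint₀.norm).mono'
      (hρ.comp ((hv n).prodMk measurable_id)).aestronglyMeasurable
      (Filter.Eventually.of_forall fun z => ?_)
    by_cases hz : z ∈ T n
    · have hz' : ‖ρ (u z) z‖ ≤ n := hz
      simpa [v, hz] using hz'.trans (le_add_of_nonneg_right (norm_nonneg _))
    · simp [v, hz]
  have hc_lim : Filter.Tendsto (fun n => ∫ z, c n z ∂F) Filter.atTop (nhds (∫ z, b z ∂F)) := by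
    refine tendsto_integral_of_dominated_convergence (fun z => |b z| + |a z|) (fun n => ?_)
      (hb_int.abs.add ha.abs) (fun n => Filter.Eventually.of_forall fun z => ?_)
      (Filter.Eventually.of_forall fun z => ?_)
    · exact AEStronglyMeasurable.piecewise (hT n) hb_int.1.restrict ha.1.restrict
    · by_cases hz : z ∈ T n <;> simp [c, hz]
    · obtain ⟨N, hN⟩ := exists_nat_ge ‖ρ (u z) z‖
      refine tendsto_const_nhds.congr' ?_
      filter_upwards [Filter.eventually_ge_atTop N] with n hn
      have hz : z ∈ T n := hN.trans (Nat.cast_le.mpr hn)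
      simp [c, hz]
  obtain ⟨n, hn⟩ := (hc_lim.eventually (lt_mem_nhds hb_pos)).exists
  refine ⟨∫ z, ρ (v n z) z ∂F,
    integral_mem_attainableMoments hG hρ.stronglyMeasurable (hv n) (hvG n) (hv_int n), ?_⟩
  rw [← integral_inner (hv_int n) l]
  have hc_int : Integrable (c n) F := by
    by_contra hcon
    rw [integral_undef hcon] at hn
    exact hn.false
  refine hn.trans_le (integral_mono_ae hc_int ((hv_int n).const_inner l) ?_)
  filter_upwards [huB] with z h
  by_cases hz : z ∈ T n
  · simpa [c, v, hz] using h.2.le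
  · simp [c, v, hz, a]

/-! ### The combined moments -/

lemma rComb_eq_finAddEquivProd_symm {U Z : Type*} {d1 d2 : ℕ}
    (r1θ : Z → EuclideanSpace ℝ (Fin d1))
    (r2θ : U → Z → EuclideanSpace ℝ (Fin d2)) (u : U) (z : Z) :
    rComb r1θ r2θ u z =
      (EuclideanSpace.finAddEquivProd (𝕜 := ℝ)).symm (r1θ z, r2θ u z) := by
  rw [ContinuousLinearEquiv.eq_symm_apply]
  ext i <;> simp [rComb, EuclideanSpace.finAddEquivProd, EuclideanSpace.sumEquivProd]

lemma exists_continuousLinearMap_rComb_eq (U Z : Type*) (d1 d2 : ℕ) :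
    ∃ P : EuclideanSpace ℝ (Fin (d1 + d2)) →L[ℝ] EuclideanSpace ℝ (Fin d2),
      ∀ (r1θ : Z → EuclideanSpace ℝ (Fin d1)) (r2θ : U → Z → EuclideanSpace ℝ (Fin d2)) u z,
        P (rComb r1θ r2θ u z) = r2θ u z := by
  refine ⟨(ContinuousLinearMap.snd ℝ _ _).comp
    (EuclideanSpace.finAddEquivProd (𝕜 := ℝ)).toContinuousLinearMap, fun r1θ r2θ u z => ?_⟩
  simp [rComb_eq_finAddEquivProd_symm]

/-- Under the lower envelope condition there is a measurable selection with integrable moments. -/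
lemma Assumption1At.exists_integrable_selection {d : ℕ} {F : Measure 𝓩} [IsProbabilityMeasure F]
    {G : Set (𝓤 × 𝓩)} {ρ : 𝓤 → 𝓩 → EuclideanSpace ℝ (Fin d)} (h : Assumption1At F G ρ) :
    ∃ u : 𝓩 → 𝓤, Measurable u ∧ (∀ᵐ z ∂F, (u z, z) ∈ G) ∧
      Integrable (fun z => ρ (u z) z) F := by
  obtain ⟨g, hg, hg_int, hgρ⟩ := h.lower_envelope
  have hne : Nonempty 𝓤 :=
    ⟨(h.nonempty_section (Classical.choice (nonempty_of_isProbabilityMeasure F))).some⟩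
  obtain ⟨u, hu, huB⟩ := exists_measurable_selection F
    (B := G ∩ {p | ‖ρ p.1 p.2‖ < g p.2 + 1})
    (h.borel_Gamma.inter (measurableSet_lt h.measurable_r.norm
      ((hg.comp measurable_snd).add measurable_const))) (by
      filter_upwards [hgρ] with z hz
      obtain ⟨_, ⟨_, ⟨v, hv, rfl⟩, rfl⟩, hlt⟩ := exists_lt_of_csInf_lt
        (((h.nonempty_section z).image _).image _) (hz.trans_lt (lt_add_one (g z)))
      exact ⟨v, hv, hlt⟩)
  refine ⟨u, hu, huB.mono fun _ hz => hz.1, (hg_int.add (integrable_const 1)).mono'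
    (h.measurable_r.comp (hu.prodMk measurable_id)).aestronglyMeasurable ?_⟩
  exact huB.mono fun z hz => le_of_lt hz.2

/-- If the support function has positive integral in every direction, then the origin is interior
to the set of attainable moments. -/
lemma zero_mem_interior_attainableMoments {d2 : ℕ} (F : Measure 𝓩) [IsProbabilityMeasure F]
    {G : Set (𝓤 × 𝓩)} (hG : MeasurableSet G) {ρ : 𝓤 → 𝓩 → EuclideanSpace ℝ (Fin d2)}
    (hρ : Measurable fun p : 𝓤 × 𝓩 => ρ p.1 p.2) {u₀ : 𝓩 → 𝓤} (hu₀ : Measurable u₀)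
    (hu₀G : ∀ᵐ z ∂F, (u₀ z, z) ∈ G) (hint₀ : Integrable (fun z => ρ (u₀ z) z) F)
    (hpos : ∀ l, ‖l‖ = 1 → 0 < integralEReal F (suppFun2 G ρ l)) :
    0 ∈ interior (attainableMoments G (fun p => ρ p.1 p.2) F) :=
  (convex_attainableMoments _ _ _).zero_mem_interior_of_forall_exists_inner_pos
    ⟨_, integral_mem_attainableMoments hG hρ.stronglyMeasurable hu₀ hu₀G hint₀⟩
    fun l hl => exists_mem_attainableMoments_inner_pos F hG hρ hu₀ hu₀G hint₀ l (hpos l hl)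

/-- If, up to arbitrarily small errors, the moment condition can be met under `F`, then it can be
met exactly under any mixture of `F` with a distribution that satisfies the latent-free moment
conditions and has the origin interior to its attainable moments. -/
lemma memIdentified_mixture {U Z : Type*} [MeasurableSpace U] [MeasurableSpace Z]
    {d1 d2 : ℕ} {G : Set (U × Z)} {r1θ : Z → EuclideanSpace ℝ (Fin d1)}
    {r2θ : U → Z → EuclideanSpace ℝ (Fin d2)} {F F₀ : Measure Z} (h1 : Integrable r1θ F₀)
    (h1_zero : ∫ z, r1θ z ∂F₀ = 0)
    (h0 : 0 ∈ interior (attainableMoments G (fun p => r2θ p.1 p.2) F₀))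
    (h1F : Integrable r1θ F) (hF : MemMomentClosure G (rComb r1θ r2θ) F) {δ : ℝ} (hδ0 : 0 < δ)
    (hδ1 : δ ≤ 1) :
    MemIdentified G (rComb r1θ r2θ)
      (ENNReal.ofReal δ • F₀ + ENNReal.ofReal (1 - δ) • F) := by
  let e := EuclideanSpace.finAddEquivProd (𝕜 := ℝ) (n := d1) (m := d2)
  let R : U × Z → EuclideanSpace ℝ (Fin (d1 + d2)) := fun p => rComb r1θ r2θ p.1 p.2
  have hR : ∀ p, R p = e.symm (r1θ p.2, r2θ p.1 p.2) := fun p =>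
    rComb_eq_finAddEquivProd_symm r1θ r2θ p.1 p.2
  have hfst : ∀ m ∈ attainableMoments G R F, (e m).1 = ∫ z, r1θ z ∂F := by
    rintro m ⟨H, -, -, rfl, hint, rfl⟩
    have h := (((ContinuousLinearMap.fst ℝ _ _).comp e.toContinuousLinearMap).integral_comp_comm
      hint).symm
    refine h.trans ?_
    rw [integral_map measurable_snd.aemeasurable h1F.1]
    simp [hR]
  have hclose : ∀ ε > 0, ∃ m ∈ attainableMoments G R F, ‖m‖ ≤ ε := fun ε hε => by
    obtain ⟨H, hp, hG, hm, hi, hle⟩ := hF ε hε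
    exact ⟨_, ⟨H, hp, hG, hm, hi, rfl⟩, hle⟩
  have hnear : ∀ S ∈ nhds (0 : EuclideanSpace ℝ (Fin (d1 + d2))),
      ∃ m ∈ attainableMoments G R F, m ∈ S := by
    intro S hS
    obtain ⟨ε, hε, hεS⟩ := Metric.nhds_basis_closedBall.mem_iff.mp hS
    obtain ⟨m, hm, hle⟩ := hclose ε hε
    exact ⟨m, hm, hεS (mem_closedBall_zero_iff.mpr hle)⟩
  have h1F_zero : ∫ z, r1θ z ∂F = 0 := by
    by_contra hne
    have hcont : Continuous fun m => (e m).1 := continuous_fst.comp e.continuous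
    obtain ⟨m, hm, hmS⟩ := hnear {m | (e m).1 ≠ ∫ z, r1θ z ∂F}
      ((isOpen_ne.preimage hcont).mem_nhds (by simpa using Ne.symm hne))
    exact hmS (hfst m hm)
  let c : ℝ := -((1 - δ) / δ)
  have hcont : Continuous fun m => c • (e m).2 := (continuous_snd.comp e.continuous).const_smul c
  obtain ⟨m, hm, hmS⟩ := hnear _ ((isOpen_interior.preimage hcont).mem_nhds (by simpa using h0))
  obtain ⟨H, hp, hG, hmap, hi, hval⟩ := interior_subset hmS
  subst hmap
  have h1H : Integrable (fun p : U × Z => r1θ p.2) H :=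
    (integrable_map_measure h1.1 measurable_snd.aemeasurable).mp h1
  have hpair : Integrable (fun p : U × Z => (r1θ p.2, r2θ p.1 p.2)) H := h1H.prodMk hi
  have hm0 : c • m ∈ attainableMoments G R (H.map Prod.snd) := by
    refine ⟨H, hp, hG, rfl, ?_, ?_⟩
    · simp only [funext hR]
      exact e.symm.toContinuousLinearMap.integrable_comp hpair
    · simp only [hR]
      refine (e.symm.toContinuousLinearMap.integral_comp_comm hpair).trans ?_
      change e.symm _ = _
      rw [ContinuousLinearEquiv.symm_apply_eq, integral_pair h1H hi, map_smul]
      refine Prod.ext ?_ hval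
      rw [Prod.smul_fst, hfst m hm, h1F_zero, smul_zero, ← h1_zero]
      exact (integral_map measurable_snd.aemeasurable h1.1).symm
  have hmix := add_mem_attainableMoments hm0 hm hδ0.le hδ1
  have hzero : δ • c • m + (1 - δ) • m = 0 := by
    rw [smul_smul, ← add_smul]
    have : δ * c + (1 - δ) = 0 := by simp only [c]; field_simp; ring
    rw [this, zero_smul]
  rwa [hzero] at hmix

lemma MemIdentified.memMomentClosure {U Z : Type*} [MeasurableSpace U]
    [MeasurableSpace Z] {d : ℕ} {G : Set (U × Z)}
    {ρ : U → Z → EuclideanSpace ℝ (Fin d)} {F : Measure Z} (h : MemIdentified G ρ F) :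
    MemMomentClosure G ρ F := by
  obtain ⟨H, hp, hG, hm, hi, h0⟩ := h
  exact fun ε hε => ⟨H, hp, hG, hm, hi, by simpa [h0] using hε.le⟩

/-- Finite-sample indistinguishability follows once every distribution in the moment closure can be
contaminated by an arbitrarily small amount of a fixed one to enter the identified set. -/
lemma indistinguishable_of_mixture {U Z : Type*} [MeasurableSpace U]
    [MeasurableSpace Z] {d : ℕ} {𝓕 : Set (Measure Z)}
    (hprob : ∀ F ∈ 𝓕, IsProbabilityMeasure F) (hconv : ConvexFamily 𝓕) {G : Set (U × Z)}
    {ρ : U → Z → EuclideanSpace ℝ (Fin d)} {F₀ : Measure Z} (hF₀ : F₀ ∈ 𝓕)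
    (hmix : ∀ F ∈ 𝓕, MemMomentClosure G ρ F → ∀ δ : ℝ, 0 < δ → δ ≤ 1 →
      MemIdentified G ρ (ENNReal.ofReal δ • F₀ + ENNReal.ofReal (1 - δ) • F)) :
    Indistinguishable 𝓕 G ρ := by
  intro n φ hφ hφ01
  set I : Measure Z → ℝ := fun F => ∫ x, φ x ∂(Measure.pi fun _ : Fin n => F)
  have hφ_int : ∀ F ∈ 𝓕, Integrable φ (Measure.pi fun _ : Fin n => F) := by
    intro F hF
    have := hprob F hF
    exact Integrable.of_bound hφ.aestronglyMeasurable 1 (Filter.Eventually.of_forall fun x => by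
      rw [Real.norm_eq_abs, abs_of_nonneg (hφ01 x).1]; exact (hφ01 x).2)
  have hI1 : ∀ F ∈ 𝓕, I F ≤ 1 := by
    intro F hF
    have := hprob F hF
    calc I F ≤ ∫ _, (1 : ℝ) ∂(Measure.pi fun _ : Fin n => F) :=
          integral_mono (hφ_int F hF) (integrable_const 1) fun x => (hφ01 x).2
      _ = 1 := by simp
  have hsub : {F ∈ 𝓕 | MemIdentified G ρ F} ⊆ {F ∈ 𝓕 | MemMomentClosure G ρ F} :=
    fun F hF => ⟨hF.1, hF.2.memMomentClosure⟩
  have hbdd : ∀ P : Measure Z → Prop, BddAbove (I '' {F ∈ 𝓕 | P F}) := by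
    intro P
    refine ⟨1, ?_⟩
    rintro _ ⟨F, hF, rfl⟩
    exact hI1 F hF.1
  rcases {F ∈ 𝓕 | MemMomentClosure G ρ F}.eq_empty_or_nonempty with hempty | ⟨F₁, hF₁, hF₁c⟩
  · have hempty' := subset_empty_iff.mp (hsub.trans hempty.subset)
    rw [hempty, hempty']
  have hmem : ∀ F ∈ 𝓕, MemMomentClosure G ρ F → ∀ δ : ℝ, 0 < δ → δ ≤ 1 →
      ENNReal.ofReal δ • F₀ + ENNReal.ofReal (1 - δ) • F ∈ {F ∈ 𝓕 | MemIdentified G ρ F} :=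
    fun F hF hFc δ hδ0 hδ1 => ⟨hconv F₀ hF₀ F hF δ hδ0.le hδ1, hmix F hF hFc δ hδ0 hδ1⟩
  have hne : {F ∈ 𝓕 | MemIdentified G ρ F}.Nonempty :=
    ⟨_, hmem F₁ hF₁ hF₁c 1 one_pos le_rfl⟩
  refine le_antisymm (csSup_le_csSup (hbdd _) (hne.image I) (image_mono hsub))
    (csSup_le ((hne.mono hsub).image I) ?_)
  rintro _ ⟨F, ⟨hF, hFc⟩, rfl⟩
  have hlower : ∀ δ : ℝ, 0 < δ → δ ≤ 1 →
      (1 - δ) ^ n * I F ≤ sSup (I '' {F ∈ 𝓕 | MemIdentified G ρ F}) := by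
    intro δ hδ0 hδ1
    have hδ := hmem F hF hFc δ hδ0 hδ1
    refine le_trans ?_ (le_csSup (hbdd _) ⟨_, hδ, rfl⟩)
    have := hprob F hF
    have := hprob _ hδ.1
    have hle := pow_smul_pi_le_pi (n := n) (F := F) (c := ENNReal.ofReal (1 - δ))
      (Measure.le_add_left (le_refl _) (ν' := ENNReal.ofReal δ • F₀))
    have h := integral_mono_measure hle (Filter.Eventually.of_forall fun x => (hφ01 x).1)
      (hφ_int _ hδ.1)
    rwa [integral_smul_measure, ENNReal.toReal_pow,
      ENNReal.toReal_ofReal (sub_nonneg.mpr hδ1), smul_eq_mul] at h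
  have hlim : Filter.Tendsto (fun δ : ℝ => (1 - δ) ^ n * I F) (nhdsWithin 0 (Ioi 0))
      (nhds (I F)) := by
    have hc : Continuous fun δ : ℝ => (1 - δ) ^ n * I F := by fun_prop
    simpa using (hc.tendsto 0).mono_left nhdsWithin_le_nhds
  refine le_of_tendsto hlim ?_
  filter_upwards [Ioc_mem_nhdsGT (zero_lt_one' ℝ)] with δ hδ
  exact hlower δ hδ.1 hδ.2

/-- **Theorem B.1 (indistinguishability under an interior distribution).**
Suppose Assumption 1 holds, `𝓕` is convex, and `r₁(·;θ)` is `F`-integrable for every `F ∈ 𝓕`.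
Fix `θ ∈ Θ`.  If there exists `F* ∈ 𝓕` with `∫ r₁(z;θ) dF* = 0` and
`inf_{λ ∈ 𝒮₂} ∫ γ₂(λ,z;θ) dF* > 0` (including the case where the infimum equals `+∞`),
then the hypothesis `θ ∈ Θ_I(F)` is impossible to distinguish from `θ ∈ Θ̄_I(F)`
in finite samples. -/
theorem interior_distribution_indistinguishable {d1 d2 : ℕ}
    (𝓕 : Set (Measure 𝓩)) (hprob : ∀ F ∈ 𝓕, IsProbabilityMeasure F)
    (hconv : ConvexFamily 𝓕)
    (Γ : Θ → Set (𝓤 × 𝓩)) (r1 : Θ → 𝓩 → EuclideanSpace ℝ (Fin d1))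
    (r2 : Θ → 𝓤 → 𝓩 → EuclideanSpace ℝ (Fin d2))
    (h1 : Assumption1 𝓕 Γ (fun θ => rComb (r1 θ) (r2 θ)))
    (hr1int : ∀ F ∈ 𝓕, ∀ θ : Θ, Integrable (r1 θ) F)
    (θ : Θ) (Fstar : Measure 𝓩) (hFstar : Fstar ∈ 𝓕)
    (hmom : ∫ z, r1 θ z ∂Fstar = 0)
    (hinf : (0 : EReal) < ⨅ l : {l : EuclideanSpace ℝ (Fin d2) // ‖l‖ = 1},
        integralEReal Fstar (suppFun2 (Γ θ) (r2 θ) l.1)) :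
    Indistinguishable 𝓕 (Γ θ) (rComb (r1 θ) (r2 θ)) := by
  have := hprob Fstar hFstar
  have hA : Assumption1At Fstar (Γ θ) (rComb (r1 θ) (r2 θ)) := h1 θ Fstar hFstar
  obtain ⟨P, hP⟩ := exists_continuousLinearMap_rComb_eq 𝓤 𝓩 d1 d2
  obtain ⟨u, hu, huG, hint⟩ := hA.exists_integrable_selection
  have hr2 : Measurable fun p : 𝓤 × 𝓩 => r2 θ p.1 p.2 := by
    simpa only [Function.comp_def, hP] using P.continuous.measurable.comp hA.measurable_r
  have hint2 : Integrable (fun z => r2 θ (u z) z) Fstar := by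
    simpa only [hP] using P.integrable_comp hint
  have hpos : ∀ l : EuclideanSpace ℝ (Fin d2), ‖l‖ = 1 →
      0 < integralEReal Fstar (suppFun2 (Γ θ) (r2 θ) l) :=
    fun l hl => hinf.trans_le (iInf_le
      (fun l : {l : EuclideanSpace ℝ (Fin d2) // ‖l‖ = 1} =>
        integralEReal Fstar (suppFun2 (Γ θ) (r2 θ) l.1)) ⟨l, hl⟩)
  have h0 : 0 ∈ interior (attainableMoments (Γ θ) (fun p => r2 θ p.1 p.2) Fstar) :=
    zero_mem_interior_attainableMoments Fstar hA.borel_Gamma hr2 hu huG hint2 hpos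
  exact indistinguishable_of_mixture hprob hconv hFstar fun F hF hFc δ hδ0 hδ1 =>
    memIdentified_mixture (hr1int Fstar hFstar θ) hmom h0 (hr1int F hF θ) hFc hδ0 hδ1

end
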